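/- Assume V is simple as a K[G]-module and admits an invariant lattice Λ₀. Let W be a simple F[G]-module that occurs with multiplicity one in Λ₀/πΛ₀, i.e., some composition series of Λ₀/πΛ₀ as an F[G]-module has exactly one factor isomorphic to W. If Λ₁ and Λ₂ are invariant lattices with soc(Λ₁/πΛ₁) ≅ W and soc(Λ₂/πΛ₂) ≅ W, then Λ₁ and Λ₂ are homothetic, i.e., Λ₂ = λΛ₁ for some λ ∈ K×. -/

import Mathlib

noncomputable section

attribute [local instance] Classical.propDecidable

open Pointwise

/-! ### Generic machinery: modules equipped with a family of endomorphisms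
indexed by a group `G` (i.e. "`R[G]`-modules"). -/

section Generic

variable {R : Type*} [CommRing R] {M : Type*} [AddCommGroup M] [Module R M]
variable {G : Type*}

/-- A submodule stable under all the endomorphisms `σ g`. -/
def ActStable (σ : G → M →ₗ[R] M) (W : Submodule R M) : Prop :=
  ∀ g : G, ∀ x ∈ W, σ g x ∈ W

/-- The subquotient `W₂ / W₁`. -/
abbrev SubQuot (W₁ W₂ : Submodule R M) : Type _ :=
  W₂ ⧸ (W₁.comap W₂.subtype)

/-- The endomorphism of `W₂/W₁` induced by `σ g` (junk value `0` if `σ g` does not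
preserve `W₁` and `W₂`). -/
noncomputable def subQuotMap (σ : G → M →ₗ[R] M) (W₁ W₂ : Submodule R M) (g : G) :
    SubQuot W₁ W₂ →ₗ[R] SubQuot W₁ W₂ :=
  if h : (∀ x ∈ W₂, σ g x ∈ W₂) ∧ ∀ x ∈ W₂, x ∈ W₁ → σ g x ∈ W₁ then
    Submodule.mapQ _ _ ((σ g).restrict (p := W₂) (q := W₂) h.1)
      (by intro x hx; exact h.2 x x.2 hx)
  else 0

/-- The endomorphism of a stable submodule `W` induced by `σ g`. -/
noncomputable def subAct (σ : G → M →ₗ[R] M) (W : Submodule R M) (g : G) : W →ₗ[R] W :=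
  if h : ∀ x ∈ W, σ g x ∈ W then (σ g).restrict h else 0

/-- The endomorphism of `M ⧸ W` induced by `σ g`. -/
noncomputable def quotMap (σ : G → M →ₗ[R] M) (W : Submodule R M) (g : G) :
    (M ⧸ W) →ₗ[R] (M ⧸ W) :=
  if h : W ≤ W.comap (σ g) then Submodule.mapQ W W (σ g) h else 0

/-- Two modules-with-`G`-action are isomorphic: there is a linear equivalence
commuting with the two actions. -/
def IsRepIso {N : Type*} [AddCommGroup N] [Module R N]
    (σ : G → M →ₗ[R] M) (τ : G → N →ₗ[R] N) : Prop :=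
  ∃ e : M ≃ₗ[R] N, ∀ (g : G) (x : M), e (σ g x) = τ g (e x)

/-- `M` with the action `σ` is a simple module-with-action. -/
def IsSimpleAct (σ : G → M →ₗ[R] M) : Prop :=
  Nontrivial M ∧ ∀ W : Submodule R M, ActStable σ W → W = ⊥ ∨ W = ⊤

/-- `W` is a simple stable submodule of `M`. -/
def IsSimpleSubmodule (σ : G → M →ₗ[R] M) (W : Submodule R M) : Prop :=
  ActStable σ W ∧ W ≠ ⊥ ∧ ∀ U : Submodule R M, ActStable σ U → U ≤ W → U = ⊥ ∨ U = W

/-- The socle: the sum of all simple stable submodules. -/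
def actSocle (σ : G → M →ₗ[R] M) : Submodule R M :=
  sSup {W | IsSimpleSubmodule σ W}

/-- The socle filtration: `socFilt σ 0 = ⊥` and `socFilt σ (k+1)` is the preimage in `M`
of the socle of `M / socFilt σ k`. -/
noncomputable def socFilt (σ : G → M →ₗ[R] M) : ℕ → Submodule R M
  | 0 => ⊥
  | k + 1 => (actSocle (quotMap σ (socFilt σ k))).comap (socFilt σ k).mkQ

/-- `(A₁, A₂)` is a sharp subquotient: every stable submodule strictly containing `A₁`
contains `A₂`. -/
def IsSharp (σ : G → M →ₗ[R] M) (A₁ A₂ : Submodule R M) : Prop :=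
  ActStable σ A₁ ∧ ActStable σ A₂ ∧ A₁ < A₂ ∧
    ∀ W : Submodule R M, ActStable σ W → A₁ < W → A₂ ≤ W

/-- `(A₁, A₂)` is an irreducible subquotient: `A₂/A₁` is simple, i.e. there is no stable
submodule strictly between `A₁` and `A₂`. -/
def IsIrredSubquot (σ : G → M →ₗ[R] M) (A₁ A₂ : Submodule R M) : Prop :=
  ActStable σ A₁ ∧ ActStable σ A₂ ∧ A₁ < A₂ ∧
    ∀ W : Submodule R M, ActStable σ W → A₁ ≤ W → W ≤ A₂ → W = A₁ ∨ W = A₂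

end Generic

/-! ### Lattices in representations over a discretely valued field -/

section LatticeDefs

variable {O : Type*} [CommRing O]
variable {V : Type*} [AddCommGroup V] [Module O V]

/-- A lattice: a finitely generated `O`-submodule of `V` spanning `V` over `K`. -/
def IsLattice (K : Type*) [Field K] [Module K V] (Λ : Submodule O V) : Prop :=
  Λ.FG ∧ Submodule.span K (Λ : Set V) = ⊤

/-- Two lattices are homothetic: `Λ' = λ • Λ` for some nonzero `λ ∈ K`. -/
def Homothetic (K : Type*) [Field K] [SMul K V] (Λ Λ' : Submodule O V) : Prop :=
  ∃ lam : K, lam ≠ 0 ∧ (Λ' : Set V) = lam • (Λ : Set V)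

end LatticeDefs

section Lattices

variable {O : Type*} [CommRing O] [IsDomain O] [IsDiscreteValuationRing O]
variable {K : Type*} [Field K] [Algebra O K] [IsFractionRing O K]
variable {G : Type*} [Group G]
variable {V : Type*} [AddCommGroup V] [Module K V] [Module O V] [IsScalarTower O K V]

/-- The submodule `πΛ`. -/
def piSmul (π : O) (Λ : Submodule O V) : Submodule O V :=
  Λ.map (LinearMap.lsmul O V π)

/-- The `O`-linear `G`-action on `V`. -/
def resAct (ρ : Representation K G V) : G → V →ₗ[O] V :=
  fun g => (ρ g).restrictScalars O

/-- `Λ` is invariant: `gΛ = Λ` for all `g ∈ G`. -/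
def IsInvariantSub (ρ : Representation K G V) (Λ : Submodule O V) : Prop :=
  ∀ g : G, Λ.map (resAct ρ g) = Λ

/-- `Λ` is normalised at `v`: `v ∈ Λ` and `v ∉ πΛ`. -/
def IsNormalizedAt (π : O) (Λ : Submodule O V) (v : V) : Prop :=
  v ∈ Λ ∧ v ∉ piSmul π Λ

/-- `Λ` is an invariant lattice, normalised at `v`, maximal under inclusion among
invariant lattices normalised at `v`. -/
def IsMaximalAt (ρ : Representation K G V) (π : O) (Λ : Submodule O V) (v : V) : Prop :=
  IsLattice K Λ ∧ IsInvariantSub ρ Λ ∧ IsNormalizedAt π Λ v ∧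
    ∀ Λ' : Submodule O V, IsLattice K Λ' → IsInvariantSub ρ Λ' → IsNormalizedAt π Λ' v →
      Λ ≤ Λ' → Λ' = Λ

/-- `Λ` is a maximal invariant lattice: maximal with respect to some nonzero `v`. -/
def IsMaximalLattice (ρ : Representation K G V) (π : O) (Λ : Submodule O V) : Prop :=
  ∃ v : V, v ≠ 0 ∧ IsMaximalAt ρ π Λ v

/-- `V` is simple as a `K[G]`-module. -/
def IsIrreducibleRep (ρ : Representation K G V) : Prop :=
  Nontrivial V ∧ ∀ W : Submodule K V, (∀ g : G, ∀ x ∈ W, ρ g x ∈ W) → W = ⊥ ∨ W = ⊤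

/-- The induced `G`-action on the reduction `Λ/πΛ`. -/
noncomputable def redAct (ρ : Representation K G V) (π : O) (Λ : Submodule O V) :
    G → SubQuot (piSmul π Λ) Λ →ₗ[O] SubQuot (piSmul π Λ) Λ :=
  subQuotMap (resAct ρ) (piSmul π Λ) Λ

/-- The map `Λ/πΛ → Λ'/πΛ'` induced by an inclusion `Λ ≤ Λ'` (junk value `0` if
`Λ ≰ Λ'`). -/
noncomputable def redMap (π : O) (Λ Λ' : Submodule O V) :
    SubQuot (piSmul π Λ) Λ →ₗ[O] SubQuot (piSmul π Λ') Λ' :=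
  if h : Λ ≤ Λ' then
    Submodule.mapQ _ _ (Submodule.inclusion h)
      (by
        intro x hx
        have hx' : (x : V) ∈ piSmul π Λ := hx
        have : (x : V) ∈ piSmul π Λ' := Submodule.map_mono h hx'
        simpa [Submodule.mem_comap] using this)
  else 0

/-- `ρ` realises a non-split extension of `A` (a module with action `τA`) by `B`
(a module with action `τB`): there are an invariant lattice `L` and submodules
`U₀ ⊆ T ⊆ U₁` of `L/πL` with `T/U₀ ≅ B`, `U₁/T ≅ A`, and `T/U₀` has no stable
complement in `U₁/U₀` (i.e. the extension `0 → B → U₁/U₀ → A → 0` does not split). -/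
def RealizesExt (ρ : Representation K G V) (π : O)
    {NA : Type*} [AddCommGroup NA] [Module O NA] {NB : Type*} [AddCommGroup NB] [Module O NB]
    (τA : G → NA →ₗ[O] NA) (τB : G → NB →ₗ[O] NB) : Prop :=
  ∃ L : Submodule O V, IsLattice K L ∧ IsInvariantSub ρ L ∧
    ∃ U₀ U₁ T : Submodule O (SubQuot (piSmul π L) L),
      ActStable (redAct ρ π L) U₀ ∧ ActStable (redAct ρ π L) U₁ ∧
      ActStable (redAct ρ π L) T ∧ U₀ ≤ T ∧ T ≤ U₁ ∧
      IsRepIso (subQuotMap (redAct ρ π L) U₀ T) τB ∧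
      IsRepIso (subQuotMap (redAct ρ π L) T U₁) τA ∧
      ¬ ∃ C : Submodule O (SubQuot (piSmul π L) L), ActStable (redAct ρ π L) C ∧
          U₀ ≤ C ∧ C ≤ U₁ ∧ C ⊓ T = U₀ ∧ C ⊔ T = U₁

end Lattices

/-- The underlying family of linear endomorphisms of a representation. -/
def ofRep {R : Type*} [CommSemiring R] {G : Type*} [Monoid G] {M : Type*} [AddCommMonoid M]
    [Module R M] (σ : Representation R G M) : G → M →ₗ[R] M := fun g => σ g

/-! ### Weighted chains in a modular lattice -/

section WeightedChains

variable {α : Type*}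

/-- `ChainWeight w a b n`: there is a maximal chain from `a` to `b` whose steps have total
weight `n`. -/
inductive ChainWeight [Preorder α] (w : α → α → ℕ) (a : α) : α → ℕ → Prop
  | refl : ChainWeight w a a 0
  | step {b c : α} {n : ℕ} : ChainWeight w a b n → b ⋖ c → ChainWeight w a c (n + w b c)

namespace ChainWeight

theorem le [Preorder α] {w : α → α → ℕ} {a b : α} {n : ℕ} (h : ChainWeight w a b n) :
    a ≤ b := by
  induction h with
  | refl => exact le_rfl
  | step _ hbc ih => exact ih.trans hbc.le

theorem single [Preorder α] {w : α → α → ℕ} {a b : α} (h : a ⋖ b) :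
    ChainWeight w a b (w a b) := by
  simpa using (ChainWeight.refl (w := w) (a := a)).step h

theorem trans [Preorder α] {w : α → α → ℕ} {a b c : α} {n m : ℕ}
    (h₁ : ChainWeight w a b n) (h₂ : ChainWeight w b c m) : ChainWeight w a c (n + m) := by
  induction h₂ with
  | refl => exact h₁
  | step _ hcd ih => exact add_assoc n _ _ ▸ ih.step hcd

theorem map [Preorder α] {w : α → α → ℕ} (e : α ≃o α) (he : ∀ x y, w (e x) (e y) = w x y)
    {a b : α} {n : ℕ} (h : ChainWeight w a b n) : ChainWeight w (e a) (e b) n := by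
  induction h with
  | refl => exact .refl
  | step _ hbc ih => exact he _ _ ▸ ih.step ((apply_covBy_apply_iff e).2 hbc)

theorem exists_covBy_le [PartialOrder α] {w : α → α → ℕ} {a b : α} {n : ℕ}
    (h : ChainWeight w a b n) (hab : a ≠ b) : ∃ c, a ⋖ c ∧ c ≤ b := by
  induction h with
  | refl => exact absurd rfl hab
  | @step b c n _ hbc ih =>
    by_cases hb : a = b
    · exact ⟨c, hb ▸ hbc, le_rfl⟩
    · obtain ⟨d, had, hdb⟩ := ih hb
      exact ⟨d, had, hdb.trans hbc.le⟩

theorem of_fin [Preorder α] {w : α → α → ℕ} (c : ℕ) (s : Fin (c + 1) → α)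
    (h : ∀ k : Fin c, s k.castSucc ⋖ s k.succ) :
    ChainWeight w (s 0) (s (Fin.last c)) (∑ k : Fin c, w (s k.castSucc) (s k.succ)) := by
  induction c with
  | zero => simpa using ChainWeight.refl
  | succ c ih =>
    rw [Fin.sum_univ_castSucc]
    have := ih (fun k => s k.castSucc) (fun k => h k.castSucc)
    exact this.step (h (Fin.last c))

variable [Lattice α] [IsModularLattice α] {w : α → α → ℕ}

theorem exists_of_covBy (hw : ∀ x y, w (x ⊓ y) x = w y (x ⊔ y)) {a c : α} {n : ℕ}
    (h : ChainWeight w a c n) : ∀ b, a ≤ b → b ⋖ c →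
      ∃ m, ChainWeight w a b m ∧ n = m + w b c := by
  induction h with
  | refl => exact fun b hab hba => absurd hab hba.lt.not_ge
  | @step b₁ c n h₁ hb₁ ih =>
    intro b hab hbc
    by_cases hb : b = b₁
    · exact ⟨n, hb ▸ h₁, by rw [hb]⟩
    have hsup : b ⊔ b₁ = c := hbc.wcovBy.sup_eq hb₁.wcovBy hb
    have hd₁ : b ⊓ b₁ ⋖ b₁ := inf_covBy_of_covBy_sup_left (hsup.symm ▸ hbc)
    have hd : b ⊓ b₁ ⋖ b := inf_covBy_of_covBy_sup_right (hsup.symm ▸ hb₁)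
    obtain ⟨m, hm, rfl⟩ := ih _ (le_inf hab h₁.le) hd₁
    refine ⟨_, hm.step hd, ?_⟩
    have e₁ := hw b b₁
    have e₂ := hw b₁ b
    rw [hsup] at e₁
    rw [inf_comm, sup_comm, hsup] at e₂
    omega

theorem unique (hw : ∀ x y, w (x ⊓ y) x = w y (x ⊔ y)) {a c : α} {n m : ℕ}
    (h : ChainWeight w a c n) (h' : ChainWeight w a c m) : n = m := by
  induction h generalizing m with
  | refl =>
    cases h' with
    | refl => rfl
    | step h hb => exact absurd h.le hb.lt.not_ge
  | step h₁ hb ih =>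
    obtain ⟨k, hk, rfl⟩ := exists_of_covBy hw h' _ h₁.le hb
    rw [ih hk]

theorem exists_sup {a c : α} {n : ℕ} (h : ChainWeight w a c n) (b : α) :
    ∃ m, ChainWeight w (a ⊔ b) (c ⊔ b) m := by
  induction h with
  | refl => exact ⟨0, .refl⟩
  | @step x y n _ hxy ih =>
    obtain ⟨m, hm⟩ := ih
    rcases hxy.eq_or_eq (c := y ⊓ (x ⊔ b)) (le_inf hxy.le le_sup_left) inf_le_left with h | h
    · have := covBy_sup_of_inf_covBy_left (h.symm ▸ hxy : y ⊓ (x ⊔ b) ⋖ y)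
      rw [← sup_assoc, sup_eq_left.2 hxy.le] at this
      exact ⟨_, hm.step this⟩
    · have : x ⊔ b = y ⊔ b :=
        le_antisymm (sup_le_sup_right hxy.le b) (sup_le (inf_eq_left.1 h) le_sup_right)
      exact ⟨m, this ▸ hm⟩

theorem exists_inf {a c : α} {n : ℕ} (h : ChainWeight w a c n) (b : α) :
    ∃ m, ChainWeight w (a ⊓ b) (c ⊓ b) m := by
  induction h with
  | refl => exact ⟨0, .refl⟩
  | @step x y n _ hxy ih =>
    obtain ⟨m, hm⟩ := ih
    rcases hxy.eq_or_eq (c := x ⊔ (y ⊓ b)) le_sup_left (sup_le hxy.le inf_le_left) with h | h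
    · have : x ⊓ b = y ⊓ b :=
        le_antisymm (inf_le_inf_right b hxy.le) (le_inf (sup_eq_left.1 h) inf_le_right)
      exact ⟨m, this ▸ hm⟩
    · have := inf_covBy_of_covBy_sup_left (h.symm ▸ hxy : x ⋖ x ⊔ (y ⊓ b))
      rw [← inf_assoc, inf_eq_left.2 hxy.le] at this
      exact ⟨_, hm.step this⟩

theorem exists_of_le {a b c d : α} {n : ℕ} (h : ChainWeight w a d n) (hab : a ≤ b)
    (hbc : b ≤ c) (hcd : c ≤ d) : ∃ m, ChainWeight w b c m := by
  obtain ⟨k, hk⟩ := h.exists_inf c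
  obtain ⟨m, hm⟩ := hk.exists_sup b
  rw [inf_eq_left.2 (hab.trans hbc), inf_eq_right.2 hcd, sup_eq_right.2 hab,
    sup_eq_left.2 hbc] at hm
  exact ⟨m, hm⟩

end ChainWeight

end WeightedChains

/-! ### Weighted chains and order automorphisms -/

section ChainAutomorphisms

variable {α : Type*} {w : α → α → ℕ}

/-- The interval `[a, b]` has a smallest element `s > a`, and the step from `a` to `s` has
weight one. -/
def HasLeastStep [Preorder α] (w : α → α → ℕ) (a b : α) : Prop :=
  ∃ s, a ⋖ s ∧ s ≤ b ∧ w a s = 1 ∧ ∀ x, a < x → x ≤ b → s ≤ x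

theorem HasLeastStep.map [Preorder α] (e : α ≃o α) (he : ∀ x y, w (e x) (e y) = w x y) {a b : α}
    (h : HasLeastStep w a b) : HasLeastStep w (e a) (e b) := by
  obtain ⟨s, has, hsb, hs, hmin⟩ := h
  refine ⟨e s, (apply_covBy_apply_iff e).2 has, e.le_iff_le.2 hsb, (he _ _).trans hs, ?_⟩
  intro x hax hxb
  rw [← e.apply_symm_apply x] at hax hxb ⊢
  exact e.le_iff_le.2 (hmin _ (e.lt_iff_lt.1 hax) (e.le_iff_le.1 hxb))

variable [Lattice α] [IsModularLattice α]

theorem ChainWeight.of_iterate_le (hw : ∀ x y, w (x ⊓ y) x = w y (x ⊔ y)) (e : α ≃o α)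
    (he : ∀ x y, w (e x) (e y) = w x y) {a b : α} {m k : ℕ} (h : ChainWeight w (e a) a m)
    (hab : e^[k] a ≤ b) (hba : b ≤ a) (hb : e b ≤ b) : ChainWeight w (e b) b m := by
  have hit : ∀ k, ∃ n, ChainWeight w (e^[k] a) a n := by
    intro k
    induction k with
    | zero => exact ⟨0, .refl⟩
    | succ k ih =>
      obtain ⟨n, hn⟩ := ih
      rw [Function.iterate_succ_apply']
      exact ⟨_, (hn.map e he).trans h⟩
  obtain ⟨n, hn⟩ := hit (k + 1)
  rw [Function.iterate_succ_apply'] at hn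
  have hab' : e (e^[k] a) ≤ e b := e.le_iff_le.2 hab
  obtain ⟨i, hi⟩ := hn.exists_of_le hab' hb hba
  obtain ⟨j, hj⟩ := hn.exists_of_le (hab'.trans hb) hba le_rfl
  have := (hi.trans hj).unique hw ((hj.map e he).trans h)
  obtain rfl : i = m := by omega
  exact hi

/-- If `l ⊓ a` were larger than `b`, the interval `[b, l]` would contain two steps of weight
one. -/
theorem HasLeastStep.inf_le (hw : ∀ x y, w (x ⊓ y) x = w y (x ⊔ y)) {a b l m : α}
    (hl : HasLeastStep w b l) (hm : HasLeastStep w a m) (h : ChainWeight w b l 1)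
    (hba : b ≤ a) (ham : a ≤ m) (hlm : l ≤ m) (hla : ¬ l ≤ a) : l ⊓ a ≤ b := by
  obtain ⟨s, hbs, hsl, hs, hsmin⟩ := hl
  obtain ⟨t, hat, -, ht, htmin⟩ := hm
  by_contra hcon
  have hsn : s ≤ l ⊓ a :=
    hsmin _ (lt_of_le_not_ge (le_inf h.le hba) hcon) inf_le_left
  have htl : t ≤ l ⊔ a :=
    htmin _ (right_lt_sup.2 hla) (sup_le hlm ham)
  have hsup : (t ⊓ l) ⊔ a = t := by
    rw [inf_comm, sup_comm, ← sup_inf_assoc_of_le l hat.le, sup_comm, inf_eq_right.2 htl]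
  have hinf : (t ⊓ l) ⊓ a = l ⊓ a := by
    rw [inf_comm t, inf_assoc, inf_eq_right.2 hat.le]
  have hcov : l ⊓ a ⋖ t ⊓ l := by
    rw [← hinf]
    exact inf_covBy_of_covBy_sup_right (hsup.symm ▸ hat)
  have hwt : w (l ⊓ a) (t ⊓ l) = 1 := by
    rw [← hinf, hw, hsup, ht]
  obtain ⟨i, hi⟩ := h.exists_of_le hbs.le hsn inf_le_left
  obtain ⟨j, hj⟩ := h.exists_of_le (le_inf h.le hba |>.trans hcov.le) inf_le_right le_rfl
  have := h.unique hw ((((ChainWeight.single hbs).trans hi).trans (.single hcov)).trans hj)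
  omega

end ChainAutomorphisms

/-! ### The lattice of stable submodules -/

section StableSubmodules

variable {R : Type*} [CommRing R] {M : Type*} [AddCommGroup M] [Module R M]
variable {N : Type*} [AddCommGroup N] [Module R N]
variable {P : Type*} [AddCommGroup P] [Module R P] {G : Type*}

theorem IsRepIso.symm {σ : G → M →ₗ[R] M} {τ : G → N →ₗ[R] N} (h : IsRepIso σ τ) :
    IsRepIso τ σ := by
  obtain ⟨e, he⟩ := h
  exact ⟨e.symm, fun g x => by rw [LinearEquiv.symm_apply_eq, he, e.apply_symm_apply]⟩

theorem IsRepIso.trans {σ : G → M →ₗ[R] M} {τ : G → N →ₗ[R] N} {υ : G → P →ₗ[R] P}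
    (h : IsRepIso σ τ) (h' : IsRepIso τ υ) : IsRepIso σ υ := by
  obtain ⟨e, he⟩ := h
  obtain ⟨f, hf⟩ := h'
  exact ⟨e.trans f, fun g x => by simp [he, hf]⟩

variable {σ : G → M →ₗ[R] M}

theorem ActStable.inf {A B : Submodule R M} (hA : ActStable σ A) (hB : ActStable σ B) :
    ActStable σ (A ⊓ B) :=
  fun g x hx => ⟨hA g x hx.1, hB g x hx.2⟩

theorem actStable_sSup {S : Set (Submodule R M)} (hS : ∀ A ∈ S, ActStable σ A) :
    ActStable σ (sSup S) := by
  intro g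
  change sSup S ≤ (sSup S).comap (σ g)
  exact sSup_le fun A hA x hx => le_sSup hA (hS A hA g x hx)

theorem ActStable.sup {A B : Submodule R M} (hA : ActStable σ A) (hB : ActStable σ B) :
    ActStable σ (A ⊔ B) := by
  rw [← sSup_pair]
  exact actStable_sSup (by simp [hA, hB])

theorem actSocle_stable : ActStable σ (actSocle σ) :=
  actStable_sSup fun _ hA => hA.1

variable (σ) in
/-- The lattice of stable submodules. -/
def stableSubmodules : Sublattice (Submodule R M) where
  carrier := {A | ActStable σ A}
  supClosed' _ hA _ hB := ActStable.sup hA hB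
  infClosed' _ hA _ hB := ActStable.inf hA hB

instance : IsModularLattice (stableSubmodules σ) where
  sup_inf_le_assoc_of_le {x} y _ h :=
    IsModularLattice.sup_inf_le_assoc_of_le (x := (x : Submodule R M)) y h

theorem subQuotMap_mk {A B : Submodule R M} (hA : ActStable σ A) (hB : ActStable σ B)
    (g : G) (x : B) :
    subQuotMap σ A B g (Submodule.Quotient.mk x) =
      Submodule.Quotient.mk ⟨σ g x, hB g x x.2⟩ := by
  rw [subQuotMap, dif_pos ⟨hB g, fun x _ hx => hA g x hx⟩]
  rfl

theorem isRepIso_subQuotMap {τ : G → N →ₗ[R] N} {A B : Submodule R M} (hA : ActStable σ A)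
    (hB : ActStable σ B) (f : B →ₗ[R] N) (hf : Function.Surjective f)
    (hker : ∀ x : B, f x = 0 ↔ (x : M) ∈ A)
    (heq : ∀ g (x : B), f ⟨σ g x, hB g x x.2⟩ = τ g (f x)) :
    IsRepIso (subQuotMap σ A B) τ := by
  have hk : A.comap B.subtype = LinearMap.ker f := by
    ext x
    simp [hker]
  refine ⟨(Submodule.quotEquivOfEq _ _ hk).trans (f.quotKerEquivOfSurjective hf), ?_⟩
  intro g x
  obtain ⟨x, rfl⟩ := Submodule.Quotient.mk_surjective _ x
  rw [subQuotMap_mk hA hB]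
  exact heq g x

theorem isRepIso_subQuotMap_inf {A B : Submodule R M} (hA : ActStable σ A)
    (hB : ActStable σ B) : IsRepIso (subQuotMap σ (A ⊓ B) A) (subQuotMap σ B (A ⊔ B)) := by
  refine isRepIso_subQuotMap (hA.inf hB) hA
    ((Submodule.mkQ _).comp (Submodule.inclusion le_sup_left)) ?_ ?_ ?_
  · intro y
    obtain ⟨⟨y, hy⟩, rfl⟩ := Submodule.Quotient.mk_surjective _ y
    obtain ⟨a, ha, b, hb, rfl⟩ := Submodule.mem_sup.1 hy
    refine ⟨⟨a, ha⟩, (Submodule.Quotient.eq _).2 ?_⟩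
    simpa using hb
  · intro x
    simp
  · intro g x
    exact (subQuotMap_mk hB (hA.sup hB) g (Submodule.inclusion le_sup_left x)).symm

theorem isRepIso_subQuotMap_map {τ : G → N →ₗ[R] N} (e : M ≃ₗ[R] N)
    (he : ∀ g x, e (σ g x) = τ g (e x)) {A B : Submodule R M} {C D : Submodule R N}
    (hA : ActStable σ A) (hB : ActStable σ B) (hC : ActStable τ C) (hD : ActStable τ D)
    (hAC : ∀ x, e x ∈ C ↔ x ∈ A) (hBD : ∀ x, e x ∈ D ↔ x ∈ B) :
    IsRepIso (subQuotMap σ A B) (subQuotMap τ C D) := by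
  refine isRepIso_subQuotMap hA hB
    ((Submodule.mkQ _).comp (e.toLinearMap.restrict fun x hx => (hBD x).2 hx)) ?_ ?_ ?_
  · intro y
    obtain ⟨⟨y, hy⟩, rfl⟩ := Submodule.Quotient.mk_surjective _ y
    refine ⟨⟨e.symm y, (hBD _).1 (by simpa using hy)⟩, ?_⟩
    refine congrArg Submodule.Quotient.mk (Subtype.ext ?_)
    simp
  · intro x
    simp [hAC]
  · intro g x
    refine Eq.trans ?_ (subQuotMap_mk hC hD g _).symm
    refine congrArg Submodule.Quotient.mk (Subtype.ext ?_)
    exact he g x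

variable (σ) in
/-- The indicator of `B / A` being isomorphic to `τ`. -/
def isoWeight (τ : G → N →ₗ[R] N) (A B : stableSubmodules σ) : ℕ :=
  if IsRepIso (subQuotMap σ (A : Submodule R M) B) τ then 1 else 0

theorem isoWeight_congr {τ : G → N →ₗ[R] N} {A B C D : stableSubmodules σ}
    (h : IsRepIso (subQuotMap σ (A : Submodule R M) B) (subQuotMap σ (C : Submodule R M) D)) :
    isoWeight σ τ A B = isoWeight σ τ C D :=
  if_congr ⟨h.symm.trans, h.trans⟩ rfl rfl

theorem isoWeight_inf (τ : G → N →ₗ[R] N) (A B : stableSubmodules σ) :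
    isoWeight σ τ (A ⊓ B) A = isoWeight σ τ B (A ⊔ B) :=
  isoWeight_congr (isRepIso_subQuotMap_inf A.2 B.2)

theorem covBy_of_isRepIso {τ : G → N →ₗ[R] N} (hτ : IsSimpleAct τ) {A B : stableSubmodules σ}
    (hAB : A ≤ B) (h : IsRepIso (subQuotMap σ (A : Submodule R M) B) τ) : A ⋖ B := by
  obtain ⟨e, he⟩ := h
  have key : ∀ C : stableSubmodules σ, A ≤ C → C ≤ B → C ≤ A ∨ B ≤ C := by
    intro C hAC hCB
    have hmem : ∀ x : (B : Submodule R M), e (Submodule.Quotient.mk x) ∈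
        (((C : Submodule R M).comap (B : Submodule R M).subtype).map
          (e.toLinearMap.comp (Submodule.mkQ _))) ↔ (x : M) ∈ (C : Submodule R M) := by
      intro x
      constructor
      · rintro ⟨y, hy, hyx⟩
        have := (Submodule.Quotient.eq _).1 (e.injective hyx)
        have h2 : (y : M) - x ∈ (C : Submodule R M) := hAC this
        simpa using sub_mem (show (y : M) ∈ (C : Submodule R M) from hy) h2
      · exact fun hx => ⟨x, hx, rfl⟩
    have hst : ActStable τ (((C : Submodule R M).comap (B : Submodule R M).subtype).map
        (e.toLinearMap.comp (Submodule.mkQ _))) := by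
      rintro g _ ⟨x, hx, rfl⟩
      rw [LinearMap.comp_apply, LinearEquiv.coe_coe, ← he, Submodule.mkQ_apply,
        subQuotMap_mk A.2 B.2]
      exact (hmem _).2 (C.2 g x hx)
    rcases hτ.2 _ hst with h | h
    · left
      intro x hx
      have := (hmem ⟨x, hCB hx⟩).2 hx
      rw [h, Submodule.mem_bot, e.map_eq_zero_iff, Submodule.Quotient.mk_eq_zero] at this
      exact this
    · right
      intro x hx
      exact (hmem ⟨x, hx⟩).1 (h ▸ trivial)
  refine ⟨lt_of_le_of_ne hAB ?_, fun C hAC hCB => ?_⟩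
  · rintro rfl
    obtain ⟨x, y, hxy⟩ := hτ.1
    refine hxy (e.symm.injective ?_)
    obtain ⟨u, hu⟩ := Submodule.Quotient.mk_surjective _ (e.symm x)
    obtain ⟨v, hv⟩ := Submodule.Quotient.mk_surjective _ (e.symm y)
    rw [← hu, ← hv, Submodule.Quotient.eq]
    exact (u - v).2
  · rcases key C hAC.le hCB.le with h | h
    · exact hAC.not_ge h
    · exact hCB.not_ge h

/-! #### Submodules of a subquotient -/

/-- The preimage in `M` of a submodule of `B / A`. -/
def subQuotPull (A B : Submodule R M) (U : Submodule R (SubQuot A B)) : Submodule R M :=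
  (U.comap (Submodule.mkQ _)).map B.subtype

theorem mem_subQuotPull {A B : Submodule R M} {U : Submodule R (SubQuot A B)} {x : M} :
    x ∈ subQuotPull A B U ↔ ∃ h : x ∈ B, (Submodule.Quotient.mk ⟨x, h⟩ : SubQuot A B) ∈ U := by
  constructor
  · rintro ⟨y, hy, rfl⟩
    exact ⟨y.2, hy⟩
  · rintro ⟨h, hx⟩
    exact ⟨⟨x, h⟩, hx, rfl⟩

theorem subQuotPull_le_iff {A B : Submodule R M} {U U' : Submodule R (SubQuot A B)} :
    subQuotPull A B U ≤ subQuotPull A B U' ↔ U ≤ U' := by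
  constructor
  · intro h x hx
    obtain ⟨x, rfl⟩ := Submodule.Quotient.mk_surjective _ x
    exact (mem_subQuotPull.1 (h (mem_subQuotPull.2 ⟨x.2, hx⟩))).2
  · intro h x hx
    obtain ⟨hB, hx⟩ := mem_subQuotPull.1 hx
    exact mem_subQuotPull.2 ⟨hB, h hx⟩

theorem subQuotPull_injective {A B : Submodule R M} :
    Function.Injective (subQuotPull A B) := fun _ _ h =>
  le_antisymm (subQuotPull_le_iff.1 h.le) (subQuotPull_le_iff.1 h.ge)

theorem subQuotPull_le (A B : Submodule R M) (U : Submodule R (SubQuot A B)) :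
    subQuotPull A B U ≤ B := fun _ hx => (mem_subQuotPull.1 hx).1

theorem subQuotPull_bot {A B : Submodule R M} (hAB : A ≤ B) : subQuotPull A B ⊥ = A := by
  ext x
  rw [mem_subQuotPull]
  simp only [Submodule.mem_bot, Submodule.Quotient.mk_eq_zero, Submodule.mem_comap]
  exact ⟨fun h => h.2, fun h => ⟨hAB h, h⟩⟩

theorem le_subQuotPull {A B : Submodule R M} (hAB : A ≤ B) (U : Submodule R (SubQuot A B)) :
    A ≤ subQuotPull A B U :=
  (subQuotPull_bot hAB).symm.le.trans (subQuotPull_le_iff.2 bot_le)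

theorem subQuotPull_top {A B : Submodule R M} : subQuotPull A B ⊤ = B := by
  ext x
  simp [mem_subQuotPull]

theorem subQuotPull_stable {A B : Submodule R M} (hA : ActStable σ A) (hB : ActStable σ B)
    {U : Submodule R (SubQuot A B)} (hU : ActStable (subQuotMap σ A B) U) :
    ActStable σ (subQuotPull A B U) := by
  intro g x hx
  obtain ⟨hxB, hx⟩ := mem_subQuotPull.1 hx
  refine mem_subQuotPull.2 ⟨hB g x hxB, ?_⟩
  rw [← subQuotMap_mk hA hB g ⟨x, hxB⟩]
  exact hU g _ hx

theorem exists_subQuotPull_eq {A B C : Submodule R M} (hA : ActStable σ A)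
    (hB : ActStable σ B) (hC : ActStable σ C) (hAC : A ≤ C) (hCB : C ≤ B) :
    ∃ U, ActStable (subQuotMap σ A B) U ∧ subQuotPull A B U = C := by
  refine ⟨(C.comap B.subtype).map (Submodule.mkQ _), ?_, ?_⟩
  · rintro g _ ⟨x, hx, rfl⟩
    exact ⟨⟨σ g x, hB g x x.2⟩, hC g x hx, (subQuotMap_mk hA hB g x).symm⟩
  · ext x
    rw [mem_subQuotPull]
    constructor
    · rintro ⟨hxB, y, hy, hyx⟩
      have h2 : (y : M) - x ∈ C := hAC ((Submodule.Quotient.eq (A.comap B.subtype)).1 hyx)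
      simpa using sub_mem (show (y : M) ∈ C from hy) h2
    · exact fun hx => ⟨hCB hx, ⟨x, hCB hx⟩, hx, rfl⟩

/-- The projection from the preimage of `U` to `U`. -/
def subQuotPullProj (A B : Submodule R M) (U : Submodule R (SubQuot A B)) :
    subQuotPull A B U →ₗ[R] U :=
  ((Submodule.mkQ _).comp (Submodule.inclusion (subQuotPull_le A B U))).codRestrict U
    fun x => (mem_subQuotPull.1 x.2).2

theorem subQuotPullProj_surjective (A B : Submodule R M) (U : Submodule R (SubQuot A B)) :
    Function.Surjective (subQuotPullProj A B U) := by
  rintro ⟨u, hu⟩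
  obtain ⟨x, rfl⟩ := Submodule.Quotient.mk_surjective _ u
  exact ⟨⟨x, mem_subQuotPull.2 ⟨x.2, hu⟩⟩, rfl⟩

theorem isRepIso_subQuotPull {A B : Submodule R M} (hA : ActStable σ A) (hB : ActStable σ B)
    {U U' : Submodule R (SubQuot A B)} (hU : ActStable (subQuotMap σ A B) U)
    (hU' : ActStable (subQuotMap σ A B) U') :
    IsRepIso (subQuotMap σ (subQuotPull A B U) (subQuotPull A B U'))
      (subQuotMap (subQuotMap σ A B) U U') := by
  refine isRepIso_subQuotMap (subQuotPull_stable hA hB hU) (subQuotPull_stable hA hB hU')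
    ((Submodule.mkQ _).comp (subQuotPullProj A B U'))
    ((Submodule.mkQ_surjective _).comp (subQuotPullProj_surjective A B U')) ?_ ?_
  · intro x
    rw [LinearMap.comp_apply, Submodule.mkQ_apply, Submodule.Quotient.mk_eq_zero,
      mem_subQuotPull]
    exact ⟨fun h => ⟨subQuotPull_le _ _ _ x.2, h⟩, fun h => h.2⟩
  · intro g x
    refine Eq.trans ?_ (subQuotMap_mk hU hU' g _).symm
    refine congrArg Submodule.Quotient.mk (Subtype.ext ?_)
    exact (subQuotMap_mk hA hB g (Submodule.inclusion (subQuotPull_le A B _) x)).symm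

theorem isRepIso_subAct_subQuotPull {A B : Submodule R M} (hA : ActStable σ A)
    (hB : ActStable σ B) {U : Submodule R (SubQuot A B)}
    (hU : ActStable (subQuotMap σ A B) U) :
    IsRepIso (subQuotMap σ A (subQuotPull A B U)) (subAct (subQuotMap σ A B) U) := by
  refine isRepIso_subQuotMap hA (subQuotPull_stable hA hB hU)
    (subQuotPullProj A B U) (subQuotPullProj_surjective A B U) ?_ ?_
  · intro x
    rw [← Subtype.coe_inj]
    exact Submodule.Quotient.mk_eq_zero _
  · intro g x
    rw [subAct, dif_pos (hU g)]
    refine Subtype.ext ?_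
    exact (subQuotMap_mk hA hB g (Submodule.inclusion (subQuotPull_le A B _) x)).symm

theorem subQuotPull_covBy {A B : Submodule R M} (hA : ActStable σ A) (hB : ActStable σ B)
    (hAB : A ≤ B) {U U' : Submodule R (SubQuot A B)}
    (h : IsIrredSubquot (subQuotMap σ A B) U U') :
    (⟨subQuotPull A B U, subQuotPull_stable hA hB h.1⟩ : stableSubmodules σ) ⋖
      ⟨subQuotPull A B U', subQuotPull_stable hA hB h.2.1⟩ := by
  refine ⟨?_, fun C hUC hCU => ?_⟩
  · refine lt_of_le_of_ne (subQuotPull_le_iff.2 h.2.2.1.le) fun he => h.2.2.1.ne ?_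
    exact subQuotPull_injective (congrArg Subtype.val he)
  · obtain ⟨X, hX, hXC⟩ := exists_subQuotPull_eq hA hB C.2
      ((le_subQuotPull hAB U).trans hUC.le) (LE.le.trans hCU.le (subQuotPull_le A B U'))
    have h₁ : U ≤ X := subQuotPull_le_iff.1 (hXC ▸ hUC.le)
    have h₂ : X ≤ U' := subQuotPull_le_iff.1 (hXC ▸ hCU.le)
    rcases h.2.2.2 X hX h₁ h₂ with rfl | rfl
    · exact hUC.ne (Subtype.ext hXC)
    · exact hCU.ne (Subtype.ext hXC.symm)

/-- If `A ⋖ C ≤ B`, then `C` lies in the preimage of the socle of `B / A`. -/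
theorem le_subQuotPull_actSocle {A B C : stableSubmodules σ} (hAC : A ⋖ C) (hCB : C ≤ B) :
    (C : Submodule R M) ≤
      subQuotPull (A : Submodule R M) B (actSocle (subQuotMap σ (A : Submodule R M) B)) := by
  have hAB : (A : Submodule R M) ≤ B := hAC.le.trans hCB
  obtain ⟨X, hX, hXC⟩ := exists_subQuotPull_eq A.2 B.2 C.2 hAC.le hCB
  rw [← hXC, subQuotPull_le_iff]
  refine le_sSup ⟨hX, ?_, fun U hU hUX => ?_⟩
  · rintro rfl
    rw [subQuotPull_bot hAB] at hXC
    exact hAC.ne (Subtype.ext hXC)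
  · rcases hAC.eq_or_eq (c := ⟨_, subQuotPull_stable A.2 B.2 hU⟩) (le_subQuotPull hAB U)
      ((subQuotPull_le_iff.2 hUX).trans hXC.le : subQuotPull (A : Submodule R M) B U ≤ C) with h | h
    · left
      refine subQuotPull_injective ((congrArg Subtype.val h).trans ?_)
      exact (subQuotPull_bot hAB).symm
    · right
      exact subQuotPull_injective ((congrArg Subtype.val h).trans hXC.symm)

end StableSubmodules

/-! ### Scaling of lattices -/

section Scaling

variable {O : Type*} [CommRing O] {K : Type*} [Field K] [Algebra O K]
variable {G : Type*} [Group G]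
variable {V : Type*} [AddCommGroup V] [Module K V] [Module O V] [IsScalarTower O K V]

theorem mem_scale_iff {u : K} (hu : u ≠ 0) {Λ : Submodule O V} {x : V} :
    x ∈ u • Λ ↔ u⁻¹ • x ∈ Λ := by
  rw [Submodule.mem_smul_pointwise_iff_exists]
  constructor
  · rintro ⟨y, hy, rfl⟩
    rwa [inv_smul_smul₀ hu]
  · exact fun h => ⟨_, h, smul_inv_smul₀ hu x⟩

theorem piSmul_eq_smul (π : O) (Λ : Submodule O V) : piSmul π Λ = algebraMap O K π • Λ := by
  ext x
  simp [piSmul, Submodule.mem_smul_pointwise_iff_exists]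

theorem IsInvariantSub.actStable {ρ : Representation K G V} {Λ : Submodule O V}
    (h : IsInvariantSub ρ Λ) : ActStable (resAct ρ) Λ := by
  intro g x hx
  rw [← h g]
  exact ⟨x, hx, rfl⟩

theorem ActStable.scale {ρ : Representation K G V} {Λ : Submodule O V}
    (h : ActStable (resAct ρ) Λ) (u : K) : ActStable (resAct ρ) (u • Λ) := by
  rintro g _ ⟨x, hx, rfl⟩
  exact ⟨ρ g x, h g x hx, ((ρ g).map_smul u x).symm⟩

/-- Scaling by `u`, as an automorphism of the lattice of stable submodules. -/
def scaleIso (ρ : Representation K G V) (u : K) (hu : u ≠ 0) :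
    stableSubmodules (resAct (O := O) ρ) ≃o stableSubmodules (resAct (O := O) ρ) where
  toFun Λ := ⟨u • (Λ : Submodule O V), Λ.2.scale u⟩
  invFun Λ := ⟨u⁻¹ • (Λ : Submodule O V), Λ.2.scale u⁻¹⟩
  left_inv Λ := Subtype.ext (inv_smul_smul₀ hu (Λ : Submodule O V))
  right_inv Λ := Subtype.ext (smul_inv_smul₀ hu (Λ : Submodule O V))
  map_rel_iff' {Λ Λ'} := by
    refine ⟨fun h x hx => ?_, fun h x hx => ?_⟩
    · have : u • x ∈ u • (Λ' : Submodule O V) := h (Submodule.smul_mem_pointwise_smul x u _ hx)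
      rwa [mem_scale_iff hu, inv_smul_smul₀ hu] at this
    · exact (mem_scale_iff hu).2 (h ((mem_scale_iff hu).1 hx))

theorem coe_scaleIso (ρ : Representation K G V) (u : K) (hu : u ≠ 0)
    (Λ : stableSubmodules (resAct (O := O) ρ)) :
    (scaleIso ρ u hu Λ : Submodule O V) = u • (Λ : Submodule O V) := rfl

theorem coe_scaleIso_iterate (ρ : Representation K G V) (u : K) (hu : u ≠ 0) (k : ℕ)
    (Λ : stableSubmodules (resAct (O := O) ρ)) :
    (((scaleIso ρ u hu)^[k] Λ : stableSubmodules (resAct (O := O) ρ)) : Submodule O V) =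
      u ^ k • (Λ : Submodule O V) := by
  induction k with
  | zero => simp
  | succ k ih => rw [Function.iterate_succ_apply', coe_scaleIso, ih, smul_smul, pow_succ']

theorem isoWeight_scaleIso {N : Type*} [AddCommGroup N] [Module O N] (τ : G → N →ₗ[O] N)
    (ρ : Representation K G V) (u : K) (hu : u ≠ 0)
    (Λ Λ' : stableSubmodules (resAct (O := O) ρ)) :
    isoWeight _ τ (scaleIso ρ u hu Λ) (scaleIso ρ u hu Λ') = isoWeight _ τ Λ Λ' := by
  refine isoWeight_congr (IsRepIso.symm ?_)
  refine isRepIso_subQuotMap_map ((LinearEquiv.smulOfNeZero K V u hu).restrictScalars O)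
    (fun g x => ((ρ g).map_smul u x).symm) Λ.2 Λ'.2 (Λ.2.scale u) (Λ'.2.scale u) ?_ ?_
  all_goals
    intro x
    refine (mem_scale_iff hu).trans ?_
    simp [inv_smul_smul₀ hu]

theorem algebraMap_smul_le (r : O) (Λ : Submodule O V) : algebraMap O K r • Λ ≤ Λ := by
  rintro _ ⟨x, hx, rfl⟩
  simpa using Λ.smul_mem r hx

theorem IsLattice.scale {Λ : Submodule O V} (h : IsLattice K Λ) {u : K} (hu : u ≠ 0) :
    IsLattice K (u • Λ) := by
  refine ⟨h.1.map _, eq_top_iff.2 fun v _ => ?_⟩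
  have hv : u⁻¹ • v ∈ Submodule.span K (Λ : Set V) := h.2 ▸ trivial
  rw [← Submodule.smul_mem_iff _ (inv_ne_zero hu)]
  refine Submodule.span_le.2 (fun x hx => ?_) hv
  have : u • x ∈ Submodule.span K ((u • Λ : Submodule O V) : Set V) :=
    Submodule.subset_span (Submodule.smul_mem_pointwise_smul x u Λ hx)
  exact (Submodule.smul_mem_iff _ hu).1 this

variable [IsDomain O] [IsDiscreteValuationRing O] [IsFractionRing O K]

theorem exists_pow_mul_eq_algebraMap {π : O} (hπ : Irreducible π) (a : K) :
    ∃ (n : ℕ) (r : O), algebraMap O K π ^ n * a = algebraMap O K r := by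
  obtain ⟨x, y, hy, rfl⟩ := IsFractionRing.div_surjective (A := O) a
  have hy0 := nonZeroDivisors.ne_zero hy
  obtain ⟨n, v, rfl⟩ := IsDiscreteValuationRing.eq_unit_mul_pow_irreducible hy0 hπ
  have hyK : algebraMap O K (v * π ^ n) ≠ 0 := by simpa using hy0
  refine ⟨n, ↑v⁻¹ * x, ?_⟩
  rw [mul_div_assoc', div_eq_iff hyK, ← map_pow, ← map_mul, ← map_mul]
  congr 1
  linear_combination (-(π ^ n * x)) * v.inv_mul

theorem exists_pow_smul_mem {π : O} (hπ : Irreducible π) {Λ : Submodule O V}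
    (hΛ : Submodule.span K (Λ : Set V) = ⊤) (v : V) :
    ∃ n : ℕ, algebraMap O K π ^ n • v ∈ Λ := by
  have hmono : ∀ {m n : ℕ} {v : V}, m ≤ n → algebraMap O K π ^ m • v ∈ Λ →
      algebraMap O K π ^ n • v ∈ Λ := by
    intro m n v hmn h
    rw [← Nat.sub_add_cancel hmn, pow_add, mul_smul, ← map_pow, algebraMap_smul]
    exact Λ.smul_mem _ h
  have hv : v ∈ Submodule.span K (Λ : Set V) := hΛ ▸ trivial
  induction hv using Submodule.span_induction with
  | mem x hx => exact ⟨0, by simpa using hx⟩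
  | zero => exact ⟨0, by simp⟩
  | add x y _ _ hx hy =>
    obtain ⟨m, hm⟩ := hx
    obtain ⟨n, hn⟩ := hy
    refine ⟨max m n, ?_⟩
    rw [smul_add]
    exact Λ.add_mem (hmono (le_max_left _ _) hm) (hmono (le_max_right _ _) hn)
  | smul a x _ hx =>
    obtain ⟨m, hm⟩ := hx
    obtain ⟨n, r, hr⟩ := exists_pow_mul_eq_algebraMap hπ a
    refine ⟨m + n, ?_⟩
    rw [smul_smul, pow_add, mul_assoc, hr, mul_comm, mul_smul, algebraMap_smul]
    exact Λ.smul_mem r hm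

theorem exists_pow_smul_le {π : O} (hπ : Irreducible π) {Λ Λ' : Submodule O V}
    (hΛ : Submodule.span K (Λ : Set V) = ⊤) (hΛ' : Λ'.FG) :
    ∃ n : ℕ, algebraMap O K π ^ n • Λ' ≤ Λ := by
  obtain ⟨S, rfl⟩ := hΛ'
  choose f hf using exists_pow_smul_mem (K := K) hπ hΛ
  refine ⟨S.sup f, ?_⟩
  have hp : algebraMap O K π ^ S.sup f ≠ 0 :=
    pow_ne_zero _ (by simpa using hπ.ne_zero)
  rintro _ ⟨x, hx, rfl⟩
  change algebraMap O K π ^ S.sup f • x ∈ Λ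
  induction hx using Submodule.span_induction with
  | mem x hx =>
    rw [← Nat.sub_add_cancel (Finset.le_sup (f := f) hx), pow_add, mul_smul, ← map_pow,
      algebraMap_smul]
    exact Λ.smul_mem _ (hf x)
  | zero => simp
  | add x y _ _ hx hy => rw [smul_add]; exact Λ.add_mem hx hy
  | smul a x _ hx => rw [smul_comm]; exact Λ.smul_mem a hx

/-- A lattice in a nonzero space is not infinitely divisible within another lattice. -/
theorem exists_not_le_pow_smul [Nontrivial V] {π : O} (hπ : Irreducible π) {Λ Λ' : Submodule O V}
    (hΛ : IsLattice K Λ) (hΛ' : IsLattice K Λ') :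
    ∃ n : ℕ, ¬ Λ ≤ algebraMap O K π ^ n • Λ' := by
  by_contra! hcon
  obtain ⟨n, hn⟩ := exists_pow_smul_le (K := K) hπ hΛ.2 hΛ'.1
  have h : Λ ≤ algebraMap O K π • Λ := by
    intro x hx
    have hx' := hcon (n + 1) hx
    rw [pow_succ', mul_smul] at hx'
    obtain ⟨y, hy, rfl⟩ := hx'
    exact Submodule.smul_mem_pointwise_smul y _ Λ (hn hy)
  have hbot : Λ = ⊥ := by
    refine Submodule.eq_bot_of_le_smul_of_le_jacobson_bot (Ideal.span {π}) Λ hΛ.1 ?_ ?_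
    · rw [Submodule.ideal_span_singleton_smul]
      intro x hx
      obtain ⟨y, hy, rfl⟩ := h hx
      exact ⟨y, hy, (algebraMap_smul K π y).symm⟩
    · rw [← Irreducible.maximalIdeal_eq hπ]
      exact (IsLocalRing.jacobson_eq_maximalIdeal ⊥ bot_ne_top).ge
  have := hΛ.2
  rw [hbot, Submodule.bot_coe, Submodule.span_singleton_eq_bot.2 rfl] at this
  exact bot_ne_top this

/-- If `Λ ≤ Λ'` are lattices with `Λ ⊓ πΛ' ≤ πΛ`, then `Λ = Λ'`. -/
theorem eq_of_inf_smul_le {π : O} (hπ : Irreducible π) {Λ Λ' : Submodule O V}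
    (hΛ : IsLattice K Λ) (hΛ' : IsLattice K Λ') (hle : Λ ≤ Λ')
    (h : Λ ⊓ algebraMap O K π • Λ' ≤ algebraMap O K π • Λ) : Λ = Λ' := by
  have hp : algebraMap O K π ≠ 0 := by simpa using hπ.ne_zero
  refine le_antisymm hle ?_
  obtain ⟨n, hn⟩ := exists_pow_smul_le (K := K) hπ hΛ.2 hΛ'.1
  have key : ∀ (n : ℕ) (x : V), x ∈ Λ' → algebraMap O K π ^ n • x ∈ Λ → x ∈ Λ := by
    intro n
    induction n with
    | zero => intro x _ hx; simpa using hx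
    | succ n ih =>
      intro x hx hxn
      refine ih x hx ?_
      rw [pow_succ', mul_smul] at hxn
      have hx' : algebraMap O K π ^ n • x ∈ Λ' := by
        rw [← map_pow, algebraMap_smul]
        exact Λ'.smul_mem _ hx
      have := h ⟨hxn, Submodule.smul_mem_pointwise_smul _ _ _ hx'⟩
      rwa [mem_scale_iff hp, inv_smul_smul₀ hp] at this
  exact fun x hx => key n x hx (hn (Submodule.smul_mem_pointwise_smul x _ _ hx))

/-- After scaling, one lattice lies in another but not in its multiple by `π`. -/
theorem exists_scale_le_not_le [Nontrivial V] {π : O} (hπ : Irreducible π) {Λ Λ' : Submodule O V}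
    (hΛ : IsLattice K Λ) (hΛ' : IsLattice K Λ') :
    ∃ u : K, u ≠ 0 ∧ u • Λ ≤ Λ' ∧ ¬ u • Λ ≤ algebraMap O K π • Λ' := by
  have hp : algebraMap O K π ≠ 0 := by simpa using hπ.ne_zero
  obtain ⟨k, hk⟩ := exists_pow_smul_le (K := K) hπ hΛ'.2 hΛ.1
  have hex := exists_not_le_pow_smul hπ (hΛ.scale (pow_ne_zero k hp)) hΛ'
  obtain ⟨n, hn⟩ : ∃ n, Nat.find hex = n + 1 := by
    refine Nat.exists_eq_succ_of_ne_zero fun h0 => Nat.find_spec hex ?_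
    rw [h0]
    simpa using hk
  have h₁ := Nat.find_spec hex
  have h₂ := not_not.1 (Nat.find_min hex (m := n) (by omega))
  rw [hn] at h₁
  have hpn : algebraMap O K π ^ n ≠ 0 := pow_ne_zero n hp
  refine ⟨(algebraMap O K π ^ n)⁻¹ * algebraMap O K π ^ k,
    mul_ne_zero (inv_ne_zero hpn) (pow_ne_zero k hp), ?_, fun h => h₁ ?_⟩
  · rw [mul_smul]
    rintro _ ⟨x, hx, rfl⟩
    exact (mem_scale_iff hpn).1 (h₂ hx)
  · intro x hx
    rw [pow_succ, mul_smul, mem_scale_iff hpn]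
    refine h ?_
    rw [mul_smul]
    exact Submodule.smul_mem_pointwise_smul x _ _ hx

end Scaling

/-! ### Reductions -/

section Reductions

variable {O : Type*} [CommRing O] {K : Type*} [Field K] [Algebra O K]
variable {G : Type*} [Group G]
variable {V : Type*} [AddCommGroup V] [Module K V] [Module O V] [IsScalarTower O K V]
variable {N : Type*} [AddCommGroup N] [Module O N]

theorem chainWeight_of_redAct {ρ : Representation K G V} {π : O} (hp : algebraMap O K π ≠ 0)
    (τ : G → N →ₗ[O] N) (Λ : stableSubmodules (resAct (O := O) ρ)) (c : ℕ)
    (s : Fin (c + 1) → Submodule O (SubQuot (piSmul π (Λ : Submodule O V)) Λ))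
    (h0 : s 0 = ⊥) (hc : s (Fin.last c) = ⊤)
    (hstep : ∀ k : Fin c, IsIrredSubquot (redAct ρ π (Λ : Submodule O V))
      (s k.castSucc) (s k.succ))
    (hmult : ∃! k : Fin c, IsRepIso
      (subQuotMap (redAct ρ π (Λ : Submodule O V)) (s k.castSucc) (s k.succ)) τ) :
    ChainWeight (isoWeight _ τ) (scaleIso ρ _ hp Λ) Λ 1 := by
  have hP : ActStable (resAct ρ) (piSmul π (Λ : Submodule O V)) := by
    rw [piSmul_eq_smul (K := K)]
    exact Λ.2.scale _
  have hle : piSmul π (Λ : Submodule O V) ≤ Λ := by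
    rw [piSmul_eq_smul (K := K)]
    exact algebraMap_smul_le π _
  have hs : ∀ k, ActStable (redAct ρ π (Λ : Submodule O V)) (s k) := by
    intro k
    induction k using Fin.cases with
    | zero =>
      rintro g x hx
      rw [h0, Submodule.mem_bot] at hx ⊢
      rw [hx, map_zero]
    | succ k => exact (hstep k).2.1
  have key := ChainWeight.of_fin (w := isoWeight _ τ) c
    (fun k => (⟨subQuotPull _ _ (s k), subQuotPull_stable hP Λ.2 (hs k)⟩ :
      stableSubmodules (resAct (O := O) ρ)))
    (fun k => subQuotPull_covBy hP Λ.2 hle (hstep k))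
  convert key using 1
  · refine Subtype.ext ?_
    simp only [h0, subQuotPull_bot hle, coe_scaleIso, piSmul_eq_smul (K := K)]
  · refine Subtype.ext ?_
    simp only [hc, subQuotPull_top]
  · obtain ⟨k₀, hk₀, huniq⟩ := hmult
    have hiff : ∀ k : Fin c, IsRepIso (subQuotMap (resAct ρ) (subQuotPull _ _ (s k.castSucc))
        (subQuotPull _ _ (s k.succ))) τ ↔ k = k₀ := by
      intro k
      have := isRepIso_subQuotPull hP Λ.2 (hs k.castSucc) (hs k.succ)
      refine ⟨fun h => huniq k (this.symm.trans h), ?_⟩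
      rintro rfl
      exact this.trans hk₀
    simp only [isoWeight, hiff, Finset.sum_ite_eq', Finset.mem_univ, if_true]

theorem hasLeastStep_of_actSocle {ρ : Representation K G V} {π : O} (hp : algebraMap O K π ≠ 0)
    {τ : G → N →ₗ[O] N} (hτ : IsSimpleAct τ) (Λ : stableSubmodules (resAct (O := O) ρ))
    {n : ℕ} (hΛ : ChainWeight (isoWeight _ τ) (scaleIso ρ _ hp Λ) Λ n)
    (hsoc : IsRepIso (subAct (redAct ρ π (Λ : Submodule O V))
      (actSocle (redAct ρ π (Λ : Submodule O V)))) τ) :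
    HasLeastStep (isoWeight _ τ) (scaleIso ρ _ hp Λ) Λ := by
  set P := scaleIso ρ _ hp Λ with hPdef
  have hPeq : piSmul π (Λ : Submodule O V) = P := piSmul_eq_smul (K := K) π _
  rw [redAct, hPeq] at hsoc
  have hiso := (isRepIso_subAct_subQuotPull P.2 Λ.2 actSocle_stable).trans hsoc
  set S : stableSubmodules (resAct (O := O) ρ) :=
    ⟨_, subQuotPull_stable P.2 Λ.2 actSocle_stable⟩ with hS
  have hPS : P ⋖ S := covBy_of_isRepIso hτ (le_subQuotPull hΛ.le _) hiso
  refine ⟨S, hPS, subQuotPull_le _ _ _, if_pos hiso, fun X hPX hXΛ => ?_⟩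
  obtain ⟨k, hk⟩ := hΛ.exists_of_le le_rfl hPX.le hXΛ
  obtain ⟨C, hPC, hCX⟩ := hk.exists_covBy_le hPX.ne
  have hCS : C ≤ S := le_subQuotPull_actSocle hPC (hCX.trans hXΛ)
  rcases hPS.eq_or_eq hPC.le hCS with h | h
  · exact absurd h hPC.ne'
  · exact h ▸ hCX

end Reductions

section Statement

variable {O : Type*} [CommRing O] [IsDomain O] [IsDiscreteValuationRing O]
variable {K : Type*} [Field K] [Algebra O K] [IsFractionRing O K]
variable {G : Type*} [Group G]
variable {V : Type*} [AddCommGroup V] [Module K V] [Module O V] [IsScalarTower O K V]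
variable [FiniteDimensional K V]

theorem statement_9 (π : O) (hπ : Irreducible π) (ρ : Representation K G V)
    (hirr : IsIrreducibleRep ρ) (Λ₀ : Submodule O V) (hlat₀ : IsLattice K Λ₀)
    (hinv₀ : IsInvariantSub ρ Λ₀)
    {W : Type*} [AddCommGroup W] [Module O W] (σW : Representation O G W)
    (htor : ∀ x : W, π • x = 0) (hsimple : IsSimpleAct (ofRep σW))
    (c : ℕ) (s : Fin (c + 1) → Submodule O (SubQuot (piSmul π Λ₀) Λ₀))
    (h0 : s 0 = ⊥) (hc : s (Fin.last c) = ⊤)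
    (hstep : ∀ k : Fin c, IsIrredSubquot (redAct ρ π Λ₀) (s k.castSucc) (s k.succ))
    (hmult : ∃! k : Fin c,
      IsRepIso (subQuotMap (redAct ρ π Λ₀) (s k.castSucc) (s k.succ)) (ofRep σW))
    (Λ₁ Λ₂ : Submodule O V) (hlat₁ : IsLattice K Λ₁) (hinv₁ : IsInvariantSub ρ Λ₁)
    (hlat₂ : IsLattice K Λ₂) (hinv₂ : IsInvariantSub ρ Λ₂)
    (hsoc₁ : IsRepIso (subAct (redAct ρ π Λ₁) (actSocle (redAct ρ π Λ₁))) (ofRep σW))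
    (hsoc₂ : IsRepIso (subAct (redAct ρ π Λ₂) (actSocle (redAct ρ π Λ₂))) (ofRep σW)) :
    Homothetic K Λ₁ Λ₂ := by
  have : Nontrivial V := hirr.1
  have hp : algebraMap O K π ≠ 0 := by simpa using hπ.ne_zero
  have hw := isoWeight_inf (σ := resAct (O := O) ρ) (ofRep σW)
  have he := isoWeight_scaleIso (O := O) (ofRep σW) ρ
  let α := stableSubmodules (resAct (O := O) ρ)
  let θ := scaleIso (O := O) ρ _ hp
  have hbase : ChainWeight (isoWeight _ (ofRep σW)) (θ ⟨Λ₀, hinv₀.actStable⟩)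
      ⟨Λ₀, hinv₀.actStable⟩ 1 :=
    chainWeight_of_redAct hp _ ⟨Λ₀, hinv₀.actStable⟩ c s h0 hc hstep hmult
  have hθ (u : K) (hu : u ≠ 0) (Λ : α) : θ (scaleIso ρ u hu Λ) = scaleIso ρ u hu (θ Λ) :=
    Subtype.ext (smul_comm (algebraMap O K π) u (Λ : Submodule O V))
  have hall : ∀ Λ : α, IsLattice K (Λ : Submodule O V) →
      ChainWeight (isoWeight _ (ofRep σW)) (θ Λ) Λ 1 := by
    intro Λ hΛ
    obtain ⟨b, hb⟩ := exists_pow_smul_le (K := K) hπ hlat₀.2 hΛ.1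
    have hpb := pow_ne_zero b hp
    obtain ⟨a, ha⟩ := exists_pow_smul_le (K := K) hπ (hΛ.scale hpb).2 hlat₀.1
    have h : ChainWeight (isoWeight _ (ofRep σW)) (θ (scaleIso ρ _ hpb Λ))
        (scaleIso ρ _ hpb Λ) 1 := by
      refine hbase.of_iterate_le (k := a) hw θ (he _ hp) ?_ hb (algebraMap_smul_le π _)
      exact (coe_scaleIso_iterate ρ _ hp a _).trans_le ha
    have := h.map (scaleIso ρ _ (inv_ne_zero hpb)) (he _ (inv_ne_zero hpb))
    have hcancel (X : α) : scaleIso ρ _ (inv_ne_zero hpb) (scaleIso ρ _ hpb X) = X :=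
      Subtype.ext (inv_smul_smul₀ hpb (X : Submodule O V))
    rwa [hθ, hcancel, hcancel] at this
  have hleast₁ := hasLeastStep_of_actSocle hp hsimple ⟨Λ₁, hinv₁.actStable⟩
    (hall ⟨Λ₁, hinv₁.actStable⟩ hlat₁) hsoc₁
  have hleast₂ := hasLeastStep_of_actSocle hp hsimple ⟨Λ₂, hinv₂.actStable⟩
    (hall ⟨Λ₂, hinv₂.actStable⟩ hlat₂) hsoc₂
  obtain ⟨u, hu, hle, hnle⟩ := exists_scale_le_not_le hπ hlat₁ hlat₂
  have hleast := hleast₁.map (scaleIso ρ u hu) (he u hu)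
  rw [← hθ] at hleast
  have hinf := hleast.inf_le hw hleast₂
    (hall (scaleIso ρ u hu ⟨Λ₁, hinv₁.actStable⟩) (hlat₁.scale hu))
    (θ.le_iff_le.2 hle) (algebraMap_smul_le π Λ₂) hle hnle
  refine ⟨u, hu, ?_⟩
  rw [← eq_of_inf_smul_le hπ (hlat₁.scale hu) hlat₂ hle hinf, Submodule.coe_pointwise_smul]

end Statement
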